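/- Suppose matrices Φ_x ∈ R^{n(T+1) x n(T+1)}, Φ_u ∈ R^{m(T+1) x n(T+1)} satisfy (I - ZA)Φ_x - ZB·Φ_u = I, with Φ_x block lower-triangular with identity diagonal blocks (hence invertible). Then setting K = Φ_u·Φ_x^{-1}, one has (I - ZA - ZBK)^{-1} = Φ_x and K·(I - ZA - ZBK)^{-1} = Φ_u. -/

import Mathlib

/-- A block lower-triangular matrix with identity diagonal blocks has determinant one. -/
theorem Matrix.det_eq_one_of_blockLowerTriangular {ι κ R : Type*} [CommRing R]
    [Fintype ι] [LinearOrder ι] [Fintype κ] [DecidableEq κ] {M : Matrix (ι × κ) (ι × κ) R}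
    (hlow : ∀ (i j : ι) (a b : κ), i < j → M (i, a) (j, b) = 0)
    (hdiag : ∀ (i : ι) (a b : κ), M (i, a) (i, b) = if a = b then 1 else 0) :
    M.det = 1 := by
  have htri : M.BlockTriangular fun p => OrderDual.toDual p.1 :=
    fun p q hpq => hlow p.1 q.1 p.2 q.2 hpq
  rw [htri.det_fintype]
  refine Finset.prod_eq_one fun k _ => ?_
  have hblock : M.toSquareBlock (fun p => OrderDual.toDual p.1) k = 1 := by
    ext ⟨⟨i, a⟩, rfl⟩ ⟨⟨j, b⟩, hj⟩
    obtain rfl : j = i := OrderDual.toDual.injective hj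
    simp [Matrix.toSquareBlock_def, Matrix.one_apply, hdiag]
  rw [hblock, Matrix.det_one]


/-- If Φ_x, Φ_u satisfy (I - ZA)Φ_x - ZB·Φ_u = I, with Φ_x block
lower-triangular with identity diagonal blocks (hence invertible), then the
controller K = Φ_u·Φ_x⁻¹ achieves (I - ZA - ZBK)⁻¹ = Φ_x and
K·(I - ZA - ZBK)⁻¹ = Φ_u. -/
theorem sls_controller_achieves_responses (n m T : ℕ)
    (Z A : Matrix (Fin (T + 1) × Fin n) (Fin (T + 1) × Fin n) ℝ)
    (B : Matrix (Fin (T + 1) × Fin n) (Fin (T + 1) × Fin m) ℝ)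
    (Φx : Matrix (Fin (T + 1) × Fin n) (Fin (T + 1) × Fin n) ℝ)
    (Φu : Matrix (Fin (T + 1) × Fin m) (Fin (T + 1) × Fin n) ℝ)
    (hlow : ∀ (i j : Fin (T + 1)) (a b : Fin n), i < j → Φx (i, a) (j, b) = 0)
    (hdiag : ∀ (i : Fin (T + 1)) (a b : Fin n), Φx (i, a) (i, b) = if a = b then 1 else 0)
    (hsub : (1 - Z * A) * Φx - Z * B * Φu = 1) :
    (1 - Z * A - Z * B * (Φu * Φx⁻¹))⁻¹ = Φx ∧
    Φu * Φx⁻¹ * (1 - Z * A - Z * B * (Φu * Φx⁻¹))⁻¹ = Φu := by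
  have hunit : IsUnit Φx.det := by
    rw [Matrix.det_eq_one_of_blockLowerTriangular hlow hdiag]
    exact isUnit_one
  have hK : Φu * Φx⁻¹ * Φx = Φu := by
    rw [Matrix.mul_assoc, Matrix.nonsing_inv_mul Φx hunit, Matrix.mul_one]
  have hinv : (1 - Z * A - Z * B * (Φu * Φx⁻¹))⁻¹ = Φx := by
    refine Matrix.inv_eq_right_inv ?_
    rw [Matrix.sub_mul, Matrix.mul_assoc (Z * B), hK, hsub]
  exact ⟨hinv, by rw [hinv, hK]⟩
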